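/- Let Γ={g₁,…,g_k} be a finite admissible set of orientation-preserving circle homeomorphisms whose action is contractive, and let p=(p₁,…,p_k) be a probability vector with all pᵢ>0. Then the Iterated Function System (Γ,p) is asymptotically stable: the Markov operator P has a unique invariant Borel probability measure μ* and for every Borel probability measure μ on S¹ and every continuous f:S¹→ℝ, ∫ f d(Pⁿμ) → ∫ f dμ* as n→∞. -/

import Mathlib

open MeasureTheory Filter Topology

noncomputable section

/-- The circle `ℝ/ℤ` with normalized arc length (Haar probability measure as `volume`). -/
abbrev S1 : Type := UnitAddCircle

/-- `h` is an orientation-preserving circle homeomorphism: it admits a strictly increasing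
continuous lift `G : ℝ → ℝ` with `G (t+1) = G t + 1`. -/
def IsOPH (h : S1 ≃ₜ S1) : Prop :=
  ∃ G : ℝ → ℝ, StrictMono G ∧ Continuous G ∧ (∀ t, G (t + 1) = G t + 1) ∧
    ∀ t : ℝ, h ((t : ℝ) : S1) = ((G t : ℝ) : S1)

/-- For a word `w = [i₁, …, i_n]`, `applyWord g w = g_{i_n} ∘ ⋯ ∘ g_{i_1}`. -/
def applyWord {k : ℕ} (g : Fin k → S1 ≃ₜ S1) (w : List (Fin k)) (x : S1) : S1 :=
  w.foldl (fun y i => g i y) x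

/-- `Γ` is admissible: some generator has a dense forward orbit `{gᵢⁿ x : n ≥ 1}`. -/
def Admissible {k : ℕ} (g : Fin k → S1 ≃ₜ S1) : Prop :=
  ∃ i : Fin k, ∃ x : S1, Dense (Set.range fun n : ℕ => (⇑(g i))^[n + 1] x)

/-- The action of `Γ` is contractive: every `x` has an open arc neighbourhood whose image
under suitable words has Haar measure tending to `0`. -/
def Contractive {k : ℕ} (g : Fin k → S1 ≃ₜ S1) : Prop :=
  ∀ x : S1, ∃ a b : ℝ, a < b ∧ b - a < 1 ∧
    x ∈ (fun t : ℝ => (t : S1)) '' Set.Ioo a b ∧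
    ∃ w : ℕ → List (Fin k),
      Tendsto (fun m => volume (applyWord g (w m) '' ((fun t : ℝ => (t : S1)) '' Set.Ioo a b)))
        atTop (𝓝 0)

/-- The Markov operator `P μ = ∑ᵢ pᵢ • (gᵢ)_* μ` of the IFS `(Γ, p)`. -/
def markovP {k : ℕ} (p : Fin k → ℝ) (g : Fin k → S1 ≃ₜ S1) (μ : Measure S1) : Measure S1 :=
  ∑ i : Fin k, ENNReal.ofReal (p i) • Measure.map (g i) μ

/-- The dual operator `P* f x = ∑ᵢ pᵢ f (gᵢ x)`. -/
def dualP {k : ℕ} (p : Fin k → ℝ) (g : Fin k → S1 ≃ₜ S1) (f : S1 → ℝ) (x : S1) : ℝ :=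
  ∑ i : Fin k, p i * f (g i x)

/-- Asymptotic stability of the IFS `(Γ, p)`: there is a unique invariant Borel probability
measure `μ*`, and `Pⁿ μ → μ*` weakly for every Borel probability measure `μ`. -/
def AsympStable {k : ℕ} (p : Fin k → ℝ) (g : Fin k → S1 ≃ₜ S1) : Prop :=
  ∃ μs : Measure S1, IsProbabilityMeasure μs ∧ markovP p g μs = μs ∧
    (∀ ν : Measure S1, IsProbabilityMeasure ν → markovP p g ν = ν → ν = μs) ∧
    ∀ μ : Measure S1, IsProbabilityMeasure μ → ∀ f : C(S1, ℝ),
      Tendsto (fun n => ∫ x, f x ∂((markovP p g)^[n] μ)) atTop (𝓝 (∫ x, f x ∂μs))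

open Function

/-- The averaging operator `φ ↦ ∑ᵢ pᵢ φ ∘ Hᵢ` of a finite family of self-maps. -/
def avgOp {ι X : Type*} [Fintype ι] (p : ι → ℝ) (H : ι → X → X) (φ : X → ℝ) (x : X) : ℝ :=
  ∑ i, p i * φ (H i x)

theorem Ultrafilter.exists_tendsto_of_isCompact {β X : Type*} [TopologicalSpace X]
    (𝒰 : Ultrafilter β) {K : Set X} (hK : IsCompact K) {u : β → X} (hu : ∀ n, u n ∈ K) :
    ∃ l ∈ K, Tendsto u 𝒰 (𝓝 l) := by
  obtain ⟨l, hl, h⟩ := hK.ultrafilter_le_nhds (𝒰.map u)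
    (le_principal_iff.2 (Ultrafilter.mem_map.2 (Filter.Eventually.of_forall hu)))
  exact ⟨l, hl, h⟩

theorem Irrational.exists_nat_mul_add_int_mem_Ioo {α : ℝ} (hα : Irrational α) {c d : ℝ}
    (h : c < d) : ∃ (n : ℕ) (m : ℤ), (n * α + m : ℝ) ∈ Set.Ioo c d := by
  have hd : DenseRange (fun n : ℕ => n • (α : S1)) := by
    rw [← denseRange_zsmul_iff_nsmul, AddCircle.denseRange_zsmul_coe_iff]
    simpa using hα
  obtain ⟨n, y, hy, hn⟩ := hd.exists_mem_open
    (QuotientAddGroup.isOpenMap_coe (N := AddSubgroup.zmultiples (1 : ℝ)) _ isOpen_Ioo)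
    ((Set.nonempty_Ioo.2 h).image _)
  have hn' : ((y - n * α : ℝ) : S1) = 0 := by
    rw [← nsmul_eq_mul]
    exact sub_eq_zero.2 hn
  obtain ⟨m, hm⟩ := (AddCircle.coe_eq_zero_iff (1 : ℝ)).1 hn'
  refine ⟨n, m, ?_⟩
  rwa [show (n * α + m : ℝ) = y by simp at hm; linarith]

theorem eq_univ_of_closed_family {ι : Type*} {H : ι → CircleDeg1Lift} {i₀ i₁ : ι} {α : ℝ}
    (hα : Irrational α) (hrot : ∀ t, H i₀ t = t + α) (hH : Continuous (H i₁))
    (hnot : ∃ s t, H i₁ s - s < H i₁ t - t) {A : ℤ → Set ℝ} (hcl : ∀ z, IsClosed (A z))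
    (hne : ∀ z, (A z).Nonempty) (hper : ∀ z t (m : ℤ), t ∈ A z → t + m ∈ A z)
    (hmap : ∀ z i t, t ∈ A z → H i t ∈ A (z + 1)) (z : ℤ) : A z = Set.univ := by
  obtain ⟨s₀, t₀, hst⟩ := hnot
  let η : ℝ → ℝ := fun t => H i₁ t - t
  have hη : Continuous η := hH.sub continuous_id
  have hηper : ∀ t (m : ℤ), η (t + m) = η t := fun t m => by simp [η]
  have hrange : ∀ u ∈ Set.Icc (η s₀) (η t₀), ∃ s, η s = u := fun u hu =>
    mem_range_of_exists_le_of_exists_ge hη ⟨s₀, hu.1⟩ ⟨t₀, hu.2⟩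
  have hrotn : ∀ (n : ℕ) z t, t ∈ A z → t + n * α ∈ A (z + n) := fun n => by
    induction n with
    | zero => intro z t ht; simpa using ht
    | succ n ih =>
      intro z t ht
      have := hmap _ i₀ _ (ih z t ht)
      rw [hrot] at this
      rw [show z + ((n + 1 : ℕ) : ℤ) = z + n + 1 by push_cast; ring]
      convert this using 1
      push_cast
      ring
  have claim : ∀ (N : ℕ) z, ∃ b, ∀ v ∈ Set.Icc (N * η s₀) (N * η t₀), b + v ∈ A z := fun N => by
    induction N with
    | zero =>
      intro z
      obtain ⟨b, hb⟩ := hne z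
      exact ⟨b, fun v hv => by simp at hv; simpa [hv] using hb⟩
    | succ N ih =>
      intro z
      choose b hb using fun k : ℕ => ih (z - k - 1)
      let b' : ℕ → ℝ := fun k => Int.fract (b k + k * α)
      have hb' : ∀ k j : ℕ, j ≤ k → ∀ v ∈ Set.Icc (N * η s₀) (N * η t₀),
          b' k + v + η (b' k + v - j * α) ∈ A z := by
        intro k j hjk v hv
        have h1 := hrotn (k - j) _ _ (hb k v hv)
        have h2 := hrotn j _ _ (hmap _ i₁ _ h1)
        have h3 := hper _ _ (-⌊b k + k * α⌋) h2
        have e1 : b' k = b k + k * α + ((-⌊b k + k * α⌋ : ℤ) : ℝ) := by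
          simp [b', Int.fract, sub_eq_add_neg]
        have e2 : b' k + v - j * α =
            (b k + v + ((k - j : ℕ) : ℝ) * α) + ((-⌊b k + k * α⌋ : ℤ) : ℝ) := by
          rw [e1, Nat.cast_sub hjk]; ring
        rw [show z - k - 1 + ((k - j : ℕ) : ℤ) + 1 + j = z by omega] at h3
        rw [e2, hηper, e1]
        convert h3 using 1
        simp only [η]
        rw [Nat.cast_sub hjk]
        ring
      obtain ⟨B, -, hB⟩ := (hyperfilter ℕ).exists_tendsto_of_isCompact isCompact_Icc
        (u := b') (K := Set.Icc 0 1) fun k => ⟨Int.fract_nonneg _, (Int.fract_lt_one _).le⟩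
      have hBj : ∀ j : ℕ, ∀ v ∈ Set.Icc (N * η s₀) (N * η t₀),
          B + v + η (B + v - j * α) ∈ A z := fun j v hv => by
        have hcont : Continuous fun x => x + v + η (x + v - j * α) := by fun_prop
        refine (hcl z).mem_of_tendsto ((hcont.tendsto B).comp hB) ?_
        filter_upwards [(eventually_ge_atTop j).filter_mono Nat.hyperfilter_le_atTop] with k hk
        exact hb' k j hk v hv
      have hBs : ∀ s, ∀ v ∈ Set.Icc (N * η s₀) (N * η t₀), B + v + η s ∈ A z := fun s v hv => by
        by_contra hs
        have hopen : IsOpen {s | B + v + η s ∈ (A z)ᶜ} :=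
          (hcl z).isOpen_compl.preimage (by fun_prop)
        obtain ⟨l, u, ⟨hl, hu⟩, hI⟩ := mem_nhds_iff_exists_Ioo_subset.1 (hopen.mem_nhds hs)
        obtain ⟨n, m, h1, h2⟩ := hα.neg.exists_nat_mul_add_int_mem_Ioo
          (sub_lt_sub_right (hl.trans hu) (B + v))
        refine hI (show B + v - n * α + m ∈ Set.Ioo l u by constructor <;> linarith) ?_
        rw [hηper]
        exact hBj n v hv
      refine ⟨B, fun w hw => ?_⟩
      push_cast at hw
      obtain ⟨v, hv, u, hu, rfl⟩ : ∃ v ∈ Set.Icc (N * η s₀) (N * η t₀),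
          ∃ u ∈ Set.Icc (η s₀) (η t₀), v + u = w := by
        have h0 : (N : ℝ) * η s₀ ≤ N * η t₀ := by
          gcongr
        have h1 : η s₀ ≤ η t₀ := hst.le
        obtain ⟨hw1, hw2⟩ := hw
        rcases le_total (w - η s₀) (N * η t₀) with h | h
        · exact ⟨w - η s₀, ⟨by linarith, h⟩, η s₀, ⟨le_rfl, h1⟩, by ring⟩
        · exact ⟨N * η t₀, ⟨h0, le_rfl⟩, w - N * η t₀, ⟨by linarith, by linarith⟩, by ring⟩
      obtain ⟨s, rfl⟩ := hrange u hu
      rw [← add_assoc]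
      exact hBs s v hv
  have hpos : 0 < η t₀ - η s₀ := sub_pos.2 hst
  obtain ⟨N, hN⟩ := exists_nat_gt (1 / (η t₀ - η s₀))
  rw [div_lt_iff₀ hpos] at hN
  obtain ⟨b, hb⟩ := claim N z
  refine Set.eq_univ_of_forall fun t => ?_
  have h1 := Int.fract_nonneg (t - b - N * η s₀)
  have h2 := Int.fract_lt_one (t - b - N * η s₀)
  have h3 := hper _ _ ⌊t - b - N * η s₀⌋ (hb (N * η s₀ + Int.fract (t - b - N * η s₀))
    ⟨by linarith, by linarith⟩)
  convert h3 using 1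
  linarith [Int.floor_add_fract (t - b - N * η s₀)]

section RealLine

variable {ι : Type*} [Fintype ι] {p : ι → ℝ} {H : ι → CircleDeg1Lift}

theorem avgOp_iterate_monotone (hp : ∀ i, 0 < p i) (n : ℕ) :
    Monotone ((avgOp p fun i => H i)^[n] id) := by
  induction n with
  | zero => exact monotone_id
  | succ n ih =>
    rw [iterate_succ_apply']
    exact fun s t hst => Finset.sum_le_sum fun i _ =>
      mul_le_mul_of_nonneg_left (ih ((H i).monotone hst)) (hp i).le

theorem avgOp_iterate_add_one (hsum : ∑ i, p i = 1) (n : ℕ) (t : ℝ) :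
    (avgOp p fun i => H i)^[n] id (t + 1) = (avgOp p fun i => H i)^[n] id t + 1 := by
  induction n generalizing t with
  | zero => rfl
  | succ n ih =>
    simp only [iterate_succ_apply', avgOp, CircleDeg1Lift.map_add_one, ih, mul_add, mul_one,
      Finset.sum_add_distrib, hsum]

theorem CircleDeg1Lift.abs_sub_sub_le (f : CircleDeg1Lift) (t : ℝ) : |f t - f 0 - t| ≤ 1 := by
  rw [abs_le]
  constructor
  · linarith [f.le_map_of_map_zero t, Int.sub_one_lt_floor t]
  · linarith [f.map_le_of_map_zero t, Int.ceil_lt_add_one t]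

/-- A stationary distribution function for the inverse system, as a limit of Cesàro means. -/
theorem exists_stationary_lift (hp : ∀ i, 0 < p i) (hsum : ∑ i, p i = 1) :
    ∃ Ψ : CircleDeg1Lift, ∀ s t, ∑ i, p i * (Ψ (H i t) - Ψ (H i s)) = Ψ t - Ψ s := by
  let q : ℕ → CircleDeg1Lift := fun n =>
    ⟨⟨_, avgOp_iterate_monotone (H := H) hp n⟩, avgOp_iterate_add_one hsum n⟩
  have hq : ∀ n t, q (n + 1) t = ∑ i, p i * q n (H i t) := fun n t => by
    change (avgOp p fun i => H i)^[n + 1] id t = _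
    rw [iterate_succ_apply']
    rfl
  have hq0 : ∀ t, q 0 t = t := fun t => rfl
  let A : ℕ → ℝ → ℝ := fun n t => (∑ j ∈ Finset.range (n + 1), (q j t - q j 0)) / (n + 1)
  have hpos : ∀ n : ℕ, (0 : ℝ) < n + 1 := fun n => by positivity
  have hA : ∀ t n, A n t ∈ Set.Icc (t - 1) (t + 1) := fun t n => by
    have h1 : ∀ j, t - 1 ≤ q j t - q j 0 ∧ q j t - q j 0 ≤ t + 1 := fun j => by
      have := abs_le.1 ((q j).abs_sub_sub_le t)
      constructor <;> linarith
    constructor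
    · rw [le_div_iff₀ (hpos n)]
      simpa [mul_comm] using
        Finset.card_nsmul_le_sum (Finset.range (n + 1)) _ _ fun j _ => (h1 j).1
    · rw [div_le_iff₀ (hpos n)]
      have := Finset.sum_le_card_nsmul (Finset.range (n + 1)) _ _ fun j _ => (h1 j).2
      rw [Finset.card_range, nsmul_eq_mul, mul_comm] at this
      exact_mod_cast this
  choose Ψ _ hΨ using fun t =>
    (hyperfilter ℕ).exists_tendsto_of_isCompact isCompact_Icc (hA t)
  refine ⟨⟨⟨Ψ, fun s t hst => le_of_tendsto_of_tendsto' (hΨ s) (hΨ t) fun n => ?_⟩, fun t => ?_⟩,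
    fun s t => ?_⟩
  · have := hpos n
    simp only [A]
    gcongr
  · refine tendsto_nhds_unique (hΨ (t + 1)) (((hΨ t).add_const 1).congr fun n => ?_)
    have := hpos n
    simp only [A, CircleDeg1Lift.map_add_one, div_add_one this.ne', add_sub_right_comm _ (1 : ℝ),
      Finset.sum_add_distrib]
    simp
  · have key : ∀ n, ∑ i, p i * (A n (H i t) - A n (H i s)) - (A n t - A n s) =
        ((q (n + 1) t - q (n + 1) s) - (t - s)) / (n + 1) := fun n => by
      have h2 : ∀ a b, A n b - A n a =
          (∑ j ∈ Finset.range (n + 1), (q j b - q j a)) / (n + 1) := fun a b => by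
        simp only [A]
        rw [← sub_div, ← Finset.sum_sub_distrib]
        simp
      have h3 : ∀ j, ∑ i, p i * (q j (H i t) - q j (H i s)) = q (j + 1) t - q (j + 1) s :=
        fun j => by simp only [hq, mul_sub, Finset.sum_sub_distrib]
      simp only [h2, ← mul_div_assoc, Finset.mul_sum]
      rw [← Finset.sum_div, ← sub_div, Finset.sum_comm, Finset.sum_congr rfl fun j _ => h3 j,
        ← Finset.sum_sub_distrib, Finset.sum_range_sub fun j => q j t - q j s]
      simp [hq0]
    have hlim : Tendsto (fun n : ℕ => ((q (n + 1) t - q (n + 1) s) - (t - s)) / (n + 1))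
        (hyperfilter ℕ) (𝓝 0) := by
      have h0 : Tendsto (fun n : ℕ => 2 / ((n : ℝ) + 1)) atTop (𝓝 0) := by
        simpa [comp_def] using
          (tendsto_const_div_atTop_nhds_zero_nat (2 : ℝ)).comp (tendsto_add_atTop_nat 1)
      refine (squeeze_zero_norm (fun n => ?_) h0).mono_left Nat.hyperfilter_le_atTop
      rw [Real.norm_eq_abs, abs_div, abs_of_pos (hpos n)]
      gcongr
      have h4 := abs_le.1 ((q (n + 1)).abs_sub_sub_le t)
      have h5 := abs_le.1 ((q (n + 1)).abs_sub_sub_le s)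
      exact abs_le.2 ⟨by linarith, by linarith⟩
    have hlim' := (tendsto_finsetSum Finset.univ fun i _ =>
      ((hΨ (H i t)).sub (hΨ (H i s))).const_mul (p i)).sub ((hΨ t).sub (hΨ s))
    exact sub_eq_zero.1 (tendsto_nhds_unique hlim' (hlim.congr fun n => (key n).symm))

theorem increment_rotation_eq (hp : ∀ i, 0 < p i) {Ψ : CircleDeg1Lift}
    (hΨ : ∀ s t, ∑ i, p i * (Ψ (H i t) - Ψ (H i s)) = Ψ t - Ψ s) {i₀ : ι} {α : ℝ}
    (hrot : ∀ t, H i₀ t = t + α) {a b : ℝ} (hab : a ≤ b) (h : Ψ a = Ψ b) (n : ℕ) :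
    Ψ (a + n * α) = Ψ (b + n * α) := by
  induction n with
  | zero => simpa using h
  | succ n ih =>
    have hle : a + n * α ≤ b + n * α := by linarith
    have h0 := hΨ (a + n * α) (b + n * α)
    rw [ih, sub_self, Finset.sum_eq_zero_iff_of_nonneg fun i _ =>
      mul_nonneg (hp i).le (sub_nonneg.2 (Ψ.monotone ((H i).monotone hle)))] at h0
    have h1 := (mul_eq_zero.1 (h0 i₀ (Finset.mem_univ _))).resolve_left (hp i₀).ne'
    rw [hrot, hrot] at h1
    push_cast
    rw [add_mul, one_mul, ← add_assoc, ← add_assoc]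
    linarith

theorem strictMono_stationary_lift (hp : ∀ i, 0 < p i) {Ψ : CircleDeg1Lift}
    (hΨ : ∀ s t, ∑ i, p i * (Ψ (H i t) - Ψ (H i s)) = Ψ t - Ψ s) {i₀ : ι} {α : ℝ}
    (hα : Irrational α) (hrot : ∀ t, H i₀ t = t + α) : StrictMono Ψ := by
  refine Ψ.monotone.strictMono_of_injective fun a b h => ?_
  by_contra hne
  wlog hab : a < b generalizing a b
  · exact this b a h.symm (Ne.symm hne) (lt_of_le_of_ne (not_lt.1 hab) (Ne.symm hne))
  set l := (b - a) / 3 with hl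
  have hl0 : 0 < l := by simp only [hl]; linarith
  have hflat : ∀ s, Ψ (s + l) = Ψ s := fun s => by
    obtain ⟨n, m, h1, h2⟩ := hα.exists_nat_mul_add_int_mem_Ioo
      (show s - a - l < s - a by linarith)
    have h3 := increment_rotation_eq hp hΨ hrot hab.le h n
    have h4 : Ψ (a + n * α + m) = Ψ (b + n * α + m) := by
      rw [Ψ.map_add_int, Ψ.map_add_int, h3]
    have h5 : Ψ (a + n * α + m) ≤ Ψ s := Ψ.monotone (by linarith)
    have h6 : Ψ (s + l) ≤ Ψ (b + n * α + m) := Ψ.monotone (by linarith)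
    exact le_antisymm (by linarith) (Ψ.monotone (by linarith))
  obtain ⟨N, hN⟩ := exists_nat_gt (1 / l)
  have hN' : ∀ n : ℕ, Ψ (n * l) = Ψ 0 := fun n => by
    induction n with
    | zero => simp
    | succ n ih => rw [← ih, ← hflat (n * l)]; push_cast; ring_nf
  have h7 : Ψ (0 + 1) ≤ Ψ (N * l) := Ψ.monotone (by
    rw [div_lt_iff₀ hl0] at hN; linarith)
  rw [Ψ.map_add_one, hN'] at h7
  linarith

/-- The rotation `i₀` transports a jump of maximal size: `c` bounds from below the oscillation of
`Ψ` at `t`, and from above, up to any error, all increments at a small scale. -/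
theorem increment_rotation_ge (hp : ∀ i, 0 < p i) (hsum : ∑ i, p i = 1)
    (hH : ∀ i, Continuous (H i)) {Ψ : CircleDeg1Lift}
    (hΨ : ∀ s t, ∑ i, p i * (Ψ (H i t) - Ψ (H i s)) = Ψ t - Ψ s) {i₀ : ι} {α : ℝ}
    (hrot : ∀ t, H i₀ t = t + α) {c : ℝ}
    (hmax : ∀ η > 0, ∃ δ > 0, ∀ t, Ψ (t + δ) - Ψ (t - δ) < c + η) {t : ℝ}
    (ht : ∀ a b, a < t → t < b → c ≤ Ψ b - Ψ a) :
    ∀ a b, a < t + α → t + α < b → c ≤ Ψ b - Ψ a := by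
  classical
  intro a b ha hb
  by_contra! hlt
  set e := c - (Ψ b - Ψ a) with he
  have he0 : 0 < e := by linarith
  have hp0 := hp i₀
  obtain ⟨δ, hδ, hδ'⟩ := hmax (p i₀ * e) (mul_pos hp0 he0)
  have hnhds : ∀ i, ∀ᶠ s in 𝓝 t, H i s ∈ Set.Ioo (H i t - δ) (H i t + δ) := fun i =>
    (hH i).continuousAt.eventually (Ioo_mem_nhds (by linarith) (by linarith))
  have hnhds0 : ∀ᶠ s in 𝓝 t, H i₀ s ∈ Set.Ioo a b :=
    (hH i₀).continuousAt.eventually (Ioo_mem_nhds (by rwa [hrot]) (by rwa [hrot]))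
  obtain ⟨l, u, ⟨hl, hu⟩, hI⟩ := mem_nhds_iff_exists_Ioo_subset.1
    ((eventually_all.2 hnhds).and hnhds0)
  have hl' := hI (show (l + t) / 2 ∈ Set.Ioo l u by constructor <;> linarith)
  have hu' := hI (show (t + u) / 2 ∈ Set.Ioo l u by constructor <;> linarith)
  have h1 := ht ((l + t) / 2) ((t + u) / 2) (by linarith) (by linarith)
  rw [← hΨ, ← Finset.add_sum_erase _ _ (Finset.mem_univ i₀)] at h1
  have h2 : ∑ i ∈ Finset.univ.erase i₀,
      p i * (Ψ (H i ((t + u) / 2)) - Ψ (H i ((l + t) / 2))) ≤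
      ∑ i ∈ Finset.univ.erase i₀, p i * (c + p i₀ * e) :=
    Finset.sum_le_sum fun i _ => mul_le_mul_of_nonneg_left (by
      have h3 : Ψ (H i ((t + u) / 2)) ≤ Ψ (H i t + δ) := Ψ.monotone (hu'.1 i).2.le
      have h4 : Ψ (H i t - δ) ≤ Ψ (H i ((l + t) / 2)) := Ψ.monotone (hl'.1 i).1.le
      linarith [hδ' (H i t)]) (hp i).le
  have h5 : Ψ (H i₀ ((t + u) / 2)) - Ψ (H i₀ ((l + t) / 2)) ≤ Ψ b - Ψ a :=
    sub_le_sub (Ψ.monotone hu'.2.2.le) (Ψ.monotone hl'.2.1.le)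
  have h6 := mul_le_mul_of_nonneg_left h5 hp0.le
  rw [← Finset.sum_mul, ← sub_eq_of_eq_add'
    ((Finset.add_sum_erase _ p (Finset.mem_univ i₀)).symm), hsum] at h2
  have h7 : 0 < p i₀ * p i₀ * e := by positivity
  have h8 : Ψ b - Ψ a = c - e := by linarith
  rw [h8] at h6
  nlinarith

theorem continuous_stationary_lift (hp : ∀ i, 0 < p i) (hsum : ∑ i, p i = 1)
    (hH : ∀ i, Continuous (H i)) {Ψ : CircleDeg1Lift}
    (hΨ : ∀ s t, ∑ i, p i * (Ψ (H i t) - Ψ (H i s)) = Ψ t - Ψ s) {i₀ : ι} {α : ℝ}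
    (hα : Irrational α) (hrot : ∀ t, H i₀ t = t + α) :
    ∀ η > 0, ∃ δ > 0, ∀ t, Ψ (t + δ) - Ψ (t - δ) < η := by
  let S : Set ℝ := {c | ∀ δ > 0, ∃ t, c ≤ Ψ (t + δ) - Ψ (t - δ)}
  have hbdd : BddAbove S := ⟨1, fun c hc => by
    obtain ⟨t, ht⟩ := hc (1 / 2) (by norm_num)
    have := Ψ.map_add_one (t - 1 / 2)
    rw [show t - 1 / 2 + 1 = t + 1 / 2 by ring] at this
    linarith⟩
  have h0 : (0 : ℝ) ∈ S := fun δ hδ => ⟨0, sub_nonneg.2 (Ψ.monotone (by linarith))⟩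
  set c := sSup S with hc
  have hmax : ∀ η > 0, ∃ δ > 0, ∀ t, Ψ (t + δ) - Ψ (t - δ) < c + η := fun η hη => by
    by_contra! h
    linarith [le_csSup hbdd (show c + η ∈ S from h)]
  suffices hc0 : c ≤ 0 by
    intro η hη
    obtain ⟨δ, hδ, h⟩ := hmax η hη
    exact ⟨δ, hδ, fun t => (h t).trans_le (by linarith)⟩
  have hx : ∀ n : ℕ, ∃ t ∈ Set.Icc (0 : ℝ) 1,
      c - 1 / ((n : ℝ) + 1) ≤ Ψ (t + 1 / ((n : ℝ) + 1)) - Ψ (t - 1 / ((n : ℝ) + 1)) := fun n => by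
    have hn : (0 : ℝ) < 1 / ((n : ℝ) + 1) := by positivity
    obtain ⟨c', hc', hlt⟩ := exists_lt_of_lt_csSup ⟨0, h0⟩ (sub_lt_self c hn)
    obtain ⟨t, ht⟩ := hc' _ hn
    refine ⟨Int.fract t, ⟨Int.fract_nonneg t, (Int.fract_lt_one t).le⟩, ?_⟩
    rw [← Int.self_sub_floor, sub_add_eq_add_sub, Ψ.map_sub_int, sub_right_comm t, Ψ.map_sub_int]
    linarith
  choose x hx01 hx using hx
  obtain ⟨t, -, ht⟩ := (hyperfilter ℕ).exists_tendsto_of_isCompact isCompact_Icc hx01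
  have hinv : Tendsto (fun n : ℕ => 1 / ((n : ℝ) + 1)) (hyperfilter ℕ) (𝓝 0) :=
    tendsto_one_div_add_atTop_nhds_zero_nat.mono_left Nat.hyperfilter_le_atTop
  have hjump : ∀ a b, a < t → t < b → c ≤ Ψ b - Ψ a := fun a b ha hb => by
    have h0 := hinv.const_sub c
    rw [sub_zero] at h0
    refine le_of_tendsto h0 ?_
    have h1 := (ht.add hinv).eventually (gt_mem_nhds (show t + 0 < b by simpa))
    have h2 := (ht.sub hinv).eventually (lt_mem_nhds (show a < t - 0 by simpa))
    filter_upwards [h1, h2] with n h1 h2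
    exact (hx n).trans (sub_le_sub (Ψ.monotone h1.le) (Ψ.monotone h2.le))
  have hjumps : ∀ n : ℕ, ∀ a b, a < t + n * α → t + n * α < b → c ≤ Ψ b - Ψ a := fun n => by
    induction n with
    | zero => simpa using hjump
    | succ n ih =>
      have := increment_rotation_ge hp hsum hH hΨ hrot hmax ih
      simpa [add_mul, add_assoc] using this
  have hall : ∀ a b, a < b → c ≤ Ψ b - Ψ a := fun a b hab => by
    obtain ⟨n, m, h1, h2⟩ := hα.exists_nat_mul_add_int_mem_Ioo (sub_lt_sub_right hab t)
    have := hjumps n (a - m) (b - m) (by linarith) (by linarith)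
    simpa [Ψ.map_sub_int] using this
  have hsumc : ∀ N : ℕ, ∀ a b, a < b → N * c ≤ Ψ b - Ψ a := fun N => by
    induction N with
    | zero => exact fun a b hab => by simpa using Ψ.monotone hab.le
    | succ N ih =>
      intro a b hab
      have h1 := ih a ((a + b) / 2) (by linarith)
      have h2 := hall ((a + b) / 2) b (by linarith)
      push_cast
      linarith
  by_contra! hc0
  obtain ⟨N, hN⟩ := exists_nat_gt (1 / c)
  have h1 := hsumc N 0 (0 + 1) (by norm_num)
  rw [Ψ.map_add_one] at h1
  rw [div_lt_iff₀ hc0] at hN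
  linarith

theorem avgOp_iterate_equicontinuous (hp : ∀ i, 0 < p i) (hsum : ∑ i, p i = 1)
    (hH : ∀ i, Continuous (H i)) {i₀ : ι} {α : ℝ} (hα : Irrational α)
    (hrot : ∀ t, H i₀ t = t + α) {φ : ℝ → ℝ} (hφ : UniformContinuous φ) {C : ℝ}
    (hC : ∀ t, |φ t| ≤ C) :
    ∀ ε > 0, ∃ δ > 0, ∀ n s t, |s - t| < δ →
      |(avgOp p fun i => H i)^[n] φ s - (avgOp p fun i => H i)^[n] φ t| ≤ ε := by
  obtain ⟨Ψ, hΨ⟩ := exists_stationary_lift (H := H) hp hsum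
  have hmono := strictMono_stationary_lift hp hΨ hα hrot
  have hcont := continuous_stationary_lift hp hsum hH hΨ hα hrot
  have hΨc : Continuous Ψ := Metric.continuous_iff.2 fun t η hη => by
    obtain ⟨δ, hδ, h⟩ := hcont η hη
    refine ⟨δ, hδ, fun s hs => ?_⟩
    rw [Real.dist_eq, abs_lt] at hs ⊢
    have h1 := h t
    have h2 : Ψ s ≤ Ψ (t + δ) := Ψ.monotone (by linarith)
    have h3 : Ψ (t - δ) ≤ Ψ s := Ψ.monotone (by linarith)
    have h4 : Ψ t ≤ Ψ (t + δ) := Ψ.monotone (by linarith)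
    have h5 : Ψ (t - δ) ≤ Ψ t := Ψ.monotone (by linarith)
    constructor <;> linarith
  intro ε hε
  obtain ⟨ρ, hρ, hφρ⟩ := Metric.uniformContinuous_iff.1 hφ (ε / 2) (half_pos hε)
  obtain ⟨κ, hκ, hκΨ⟩ : ∃ κ > 0, ∀ s, κ ≤ Ψ (s + ρ) - Ψ s := by
    obtain ⟨x, -, hx⟩ := isCompact_Icc.exists_isMinOn (Set.nonempty_Icc.2 (zero_le_one' ℝ))
      (show Continuous fun s => Ψ (s + ρ) - Ψ s by fun_prop).continuousOn
    refine ⟨Ψ (x + ρ) - Ψ x, sub_pos.2 (hmono (by linarith)), fun s => ?_⟩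
    have h1 := hx ⟨Int.fract_nonneg s, (Int.fract_lt_one s).le⟩
    simpa [← Int.self_sub_floor, sub_add_eq_add_sub, Ψ.map_sub_int] using h1
  have hC0 : 0 ≤ C := (abs_nonneg _).trans (hC 0)
  set K := 2 * C / κ with hK
  have hK0 : 0 ≤ K := by positivity
  have hbound : ∀ n s t, s ≤ t → |(avgOp p fun i => H i)^[n] φ s -
      (avgOp p fun i => H i)^[n] φ t| ≤ ε / 2 + K * (Ψ t - Ψ s) := fun n => by
    induction n with
    | zero =>
      intro s t hst
      have hΨst := mul_nonneg hK0 (sub_nonneg.2 (Ψ.monotone hst))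
      rcases lt_or_ge (t - s) ρ with h | h
      · have h1 := hφρ (a := s) (b := t) (by
          rw [dist_comm, Real.dist_eq, abs_lt]; constructor <;> linarith)
        rw [Real.dist_eq] at h1
        simp only [iterate_zero, id]
        linarith
      · have h1 : κ ≤ Ψ t - Ψ s := (hκΨ s).trans (sub_le_sub_right (Ψ.monotone (by linarith)) _)
        have h2 : 2 * C ≤ K * (Ψ t - Ψ s) := by
          calc 2 * C = K * κ := by rw [hK]; field_simp
            _ ≤ _ := by gcongr
        have h3 := abs_sub (φ s) (φ t)
        simp only [iterate_zero, id]
        linarith [hC s, hC t]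
    | succ n ih =>
      intro s t hst
      simp only [iterate_succ_apply']
      rw [avgOp, avgOp, ← Finset.sum_sub_distrib]
      calc _ ≤ ∑ i, p i * (ε / 2 + K * (Ψ (H i t) - Ψ (H i s))) := by
            refine (Finset.abs_sum_le_sum_abs _ _).trans (Finset.sum_le_sum fun i _ => ?_)
            rw [← mul_sub, abs_mul, abs_of_pos (hp i)]
            exact mul_le_mul_of_nonneg_left (ih _ _ ((H i).monotone hst)) (hp i).le
        _ = ε / 2 + K * ∑ i, p i * (Ψ (H i t) - Ψ (H i s)) := by
            simp only [mul_add, Finset.sum_add_distrib, ← Finset.sum_mul, hsum, one_mul,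
              Finset.mul_sum, mul_left_comm]
        _ = _ := by rw [hΨ]
  obtain ⟨δ, hδ, h⟩ := hcont (ε / 2 / (K + 1)) (by positivity)
  refine ⟨δ, hδ, fun n s t hst => ?_⟩
  wlog hle : s ≤ t generalizing s t
  · rw [abs_sub_comm]
    exact this t s (by rwa [abs_sub_comm]) (le_of_not_ge hle)
  refine (hbound n s t hle).trans ?_
  rw [abs_lt] at hst
  have h1 : Ψ t - Ψ s ≤ ε / 2 / (K + 1) := by
    have h2 : Ψ t ≤ Ψ (s + δ) := Ψ.monotone (by linarith)
    have h3 : Ψ (s - δ) ≤ Ψ s := Ψ.monotone (by linarith)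
    linarith [h s]
  have h2 : K * (Ψ t - Ψ s) ≤ ε / 2 := by
    calc K * (Ψ t - Ψ s) ≤ (K + 1) * (Ψ t - Ψ s) := by
          gcongr
          · exact sub_nonneg.2 (Ψ.monotone hle)
          · linarith
      _ ≤ (K + 1) * (ε / 2 / (K + 1)) := by gcongr
      _ = ε / 2 := by field_simp
  linarith

theorem avgOp_iterate_add_one_of_periodic {φ : ℝ → ℝ} (hper : Periodic φ 1) (n : ℕ) :
    Periodic ((avgOp p fun i => H i)^[n] φ) 1 := by
  induction n with
  | zero => exact hper
  | succ n ih =>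
    intro t
    simp only [iterate_succ_apply', avgOp, CircleDeg1Lift.map_add_one]
    exact Finset.sum_congr rfl fun i _ => by rw [ih]

theorem avgOp_le {X : Type*} {G : ι → X → X} (hp : ∀ i, 0 < p i) (hsum : ∑ i, p i = 1)
    {φ : X → ℝ} {c : ℝ} (h : ∀ t, φ t ≤ c) (t : X) : avgOp p G φ t ≤ c :=
  calc avgOp p G φ t ≤ ∑ i, p i * c :=
        Finset.sum_le_sum fun i _ => mul_le_mul_of_nonneg_left (h _) (hp i).le
    _ = c := by rw [← Finset.sum_mul, hsum, one_mul]

theorem avgOp_iterate_le {X : Type*} {G : ι → X → X} (hp : ∀ i, 0 < p i) (hsum : ∑ i, p i = 1)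
    {φ : X → ℝ} {c : ℝ} {m n : ℕ} (hmn : m ≤ n) (h : ∀ t, (avgOp p G)^[m] φ t ≤ c) :
    ∀ t, (avgOp p G)^[n] φ t ≤ c := by
  induction n, hmn using Nat.le_induction with
  | base => exact h
  | succ n _ ih =>
    rw [iterate_succ_apply']
    exact avgOp_le hp hsum ih

theorem avgOp_neg {X : Type*} {G : ι → X → X} (φ : X → ℝ) : avgOp p G (-φ) = -avgOp p G φ := by
  ext t
  simp [avgOp]

theorem eq_of_avgOp_eq {X : Type*} {G : ι → X → X} (hp : ∀ i, 0 < p i) (hsum : ∑ i, p i = 1)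
    {φ : X → ℝ} {c : ℝ} (h : ∀ t, φ t ≤ c) {t : X} (ht : avgOp p G φ t = c) (i : ι) :
    φ (G i t) = c := by
  have h0 : ∑ i, p i * (c - φ (G i t)) = 0 := by
    simp only [mul_sub, Finset.sum_sub_distrib, ← Finset.sum_mul, hsum, one_mul]
    exact sub_eq_zero.2 ht.symm
  rw [Finset.sum_eq_zero_iff_of_nonneg fun i _ => mul_nonneg (hp i).le (sub_nonneg.2 (h _))] at h0
  have := (mul_eq_zero.1 (h0 i (Finset.mem_univ i))).resolve_left (hp i).ne'
  linarith

theorem exists_eventually_le_and_tendsto_hyperfilter (hp : ∀ i, 0 < p i) (hsum : ∑ i, p i = 1)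
    (hH : ∀ i, Continuous (H i)) {i₀ i₁ : ι} {α : ℝ} (hα : Irrational α)
    (hrot : ∀ t, H i₀ t = t + α) (hnot : ∃ s t, H i₁ s - s < H i₁ t - t) {φ : ℝ → ℝ}
    (hφ : UniformContinuous φ) (hper : Periodic φ 1) {C : ℝ} (hC : ∀ t, |φ t| ≤ C) :
    ∃ M : ℝ, (∀ c > M, ∃ N, ∀ n ≥ N, ∀ t, (avgOp p fun i => H i)^[n] φ t ≤ c) ∧
      Tendsto (fun n => (avgOp p fun i => H i)^[n] φ 0) (hyperfilter ℕ) (𝓝 M) := by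
  have hE := avgOp_iterate_equicontinuous hp hsum hH hα hrot hφ hC
  have hper' : ∀ n, Periodic ((avgOp p fun i => H i)^[n] φ) 1 :=
    avgOp_iterate_add_one_of_periodic hper
  set u : ℕ → ℝ → ℝ := fun n => (avgOp p fun i => H i)^[n] φ with hu
  have hus : ∀ n, u (n + 1) = avgOp p (fun i => H i) (u n) := fun n => iterate_succ_apply' _ _ _
  have hule : ∀ n t, u n t ≤ C := fun n =>
    avgOp_iterate_le hp hsum (Nat.zero_le n) fun t => (abs_le.1 (hC t)).2
  have hleu : ∀ n t, -C ≤ u n t := fun n => by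
    induction n with
    | zero => exact fun t => (abs_le.1 (hC t)).1
    | succ n ih =>
      intro t
      have := avgOp_le (G := fun i => H i) hp hsum (φ := -u n) (fun t => neg_le.1 (ih t)) t
      rw [avgOp_neg, ← hus] at this
      exact neg_le.1 this
  have hucont : ∀ n, Continuous (u n) := fun n => Metric.continuous_iff.2 fun t ε hε => by
    obtain ⟨δ, hδ, h⟩ := hE (ε / 2) (half_pos hε)
    exact ⟨δ, hδ, fun s hs => (h n s t hs).trans_lt (half_lt_self hε)⟩
  let S : Set ℝ := {c | ∃ n, ∀ t, u n t ≤ c}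
  have hbdd : BddBelow S := ⟨-C, fun c ⟨n, hn⟩ => (hleu n 0).trans (hn 0)⟩
  set M := sInf S with hM
  have hev : ∀ c > M, ∃ N, ∀ n ≥ N, ∀ t, u n t ≤ c := fun c hc => by
    obtain ⟨c', ⟨N, hN⟩, hlt⟩ := exists_lt_of_csInf_lt (s := S) ⟨C, 0, hule 0⟩ hc
    exact ⟨N, fun n hn => avgOp_iterate_le hp hsum hn fun t => (hN t).trans hlt.le⟩
  refine ⟨M, hev, ?_⟩
  have hmax : ∀ n, ∃ t ∈ Set.Icc (0 : ℝ) 1, M ≤ u n t := fun n => by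
    obtain ⟨x, hx, hmax⟩ := isCompact_Icc.exists_isMaxOn (Set.nonempty_Icc.2 (zero_le_one' ℝ))
      (hucont n).continuousOn
    refine ⟨x, hx, csInf_le hbdd ⟨n, fun t => ?_⟩⟩
    obtain ⟨y, hy, hty⟩ := (hper' n).exists_mem_Ico₀ zero_lt_one t
    exact hty.trans_le (hmax ⟨hy.1, hy.2.le⟩)
  choose x hx01 hx using hmax
  choose χ _ hχ using fun (z : ℤ) (t : ℝ) =>
    (hyperfilter ℕ).exists_tendsto_of_isCompact isCompact_Icc
      (u := fun n : ℕ => u ((n : ℤ) - z).toNat t) fun n => ⟨hleu _ t, hule _ t⟩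
  have hge : ∀ N : ℕ, ∀ᶠ n : ℕ in hyperfilter ℕ, N ≤ n := fun N =>
    (eventually_ge_atTop N).filter_mono Nat.hyperfilter_le_atTop
  have hχle : ∀ z t, χ z t ≤ M := fun z t => le_of_forall_gt_imp_ge_of_dense fun c hc => by
    obtain ⟨N, hN⟩ := hev c hc
    refine le_of_tendsto (hχ z t) ?_
    filter_upwards [hge (N + z.toNat)] with n hn
    exact hN _ (by omega) t
  have hχE : ∀ ε > 0, ∃ δ > 0, ∀ z s t, |s - t| < δ → |χ z s - χ z t| ≤ ε := fun ε hε => by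
    obtain ⟨δ, hδ, h⟩ := hE ε hε
    exact ⟨δ, hδ, fun z s t hst => le_of_tendsto ((hχ z s).sub (hχ z t)).abs
      (Eventually.of_forall fun n => h _ s t hst)⟩
  have hχcont : ∀ z, Continuous (χ z) := fun z => Metric.continuous_iff.2 fun t ε hε => by
    obtain ⟨δ, hδ, h⟩ := hχE (ε / 2) (half_pos hε)
    exact ⟨δ, hδ, fun s hs => (h z s t hs).trans_lt (half_lt_self hε)⟩
  have hχper : ∀ z, Periodic (χ z) 1 := fun z t =>
    tendsto_nhds_unique (hχ z (t + 1)) ((hχ z t).congr fun n => (hper' _ t).symm)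
  have hχavg : ∀ z, avgOp p (fun i => H i) (χ (z + 1)) = χ z := fun z => by
    ext t
    refine tendsto_nhds_unique (tendsto_finsetSum Finset.univ fun i _ =>
      (hχ (z + 1) (H i t)).const_mul (p i)) ((hχ z t).congr' ?_)
    filter_upwards [hge (z + 1).toNat] with n hn
    rw [show ((n : ℤ) - z).toNat = ((n : ℤ) - (z + 1)).toNat + 1 by omega, hus]
    rfl
  have hχne : ∀ z, {t | χ z t = M}.Nonempty := fun z => by
    obtain ⟨y, -, hy⟩ := (hyperfilter ℕ).exists_tendsto_of_isCompact isCompact_Icc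
      (u := fun n : ℕ => x ((n : ℤ) - z).toNat) fun n => hx01 _
    refine ⟨y, le_antisymm (hχle z y) (le_of_forall_pos_sub_le fun ε hε => ?_)⟩
    obtain ⟨δ, hδ, h⟩ := hE ε hε
    refine ge_of_tendsto (hχ z y) ?_
    filter_upwards [hy.eventually (Metric.ball_mem_nhds y hδ)] with n hn
    have h1 := abs_le.1 (h ((n : ℤ) - z).toNat _ _ hn)
    linarith [hx ((n : ℤ) - z).toNat]
  have huniv := eq_univ_of_closed_family (A := fun z => {t | χ z t = M}) hα hrot (hH i₁) hnot
    (fun z => isClosed_eq (hχcont z) continuous_const) hχne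
    (fun z t m ht => by
      have := (hχper z).int_mul m t
      rw [mul_one] at this
      exact this.trans ht)
    (fun z i t ht => eq_of_avgOp_eq (G := fun i => H i) hp hsum (hχle (z + 1))
      ((congrFun (hχavg z) t).trans ht) i) 0
  have h0 : χ 0 0 = M := Set.eq_univ_iff_forall.1 huniv 0
  simpa [h0] using hχ 0 0

/-- If one lift is an irrational translation and another one is not a translation, then the
averages of a periodic function converge uniformly to a constant. -/
theorem exists_uniform_limit_avgOp_iterate (hp : ∀ i, 0 < p i) (hsum : ∑ i, p i = 1)
    (hH : ∀ i, Continuous (H i)) {i₀ i₁ : ι} {α : ℝ} (hα : Irrational α)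
    (hrot : ∀ t, H i₀ t = t + α) (hnot : ∃ s t, H i₁ s - s < H i₁ t - t) {φ : ℝ → ℝ}
    (hφ : UniformContinuous φ) (hper : Periodic φ 1) {C : ℝ} (hC : ∀ t, |φ t| ≤ C) :
    ∃ M : ℝ, ∀ ε > 0, ∃ N, ∀ n ≥ N, ∀ t, |(avgOp p fun i => H i)^[n] φ t - M| ≤ ε := by
  obtain ⟨M, hM, hMt⟩ := exists_eventually_le_and_tendsto_hyperfilter hp hsum hH hα hrot hnot hφ
    hper hC
  obtain ⟨m, hm, hmt⟩ := exists_eventually_le_and_tendsto_hyperfilter hp hsum hH hα hrot hnot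
    (φ := -φ) hφ.neg (fun t => congrArg Neg.neg (hper t)) (C := C) (fun t => by simpa using hC t)
  have hneg : ∀ n, (avgOp p fun i => H i)^[n] (-φ) = -(avgOp p fun i => H i)^[n] φ := fun n => by
    induction n with
    | zero => rfl
    | succ n ih => rw [iterate_succ_apply', iterate_succ_apply', ih, avgOp_neg]
  simp only [hneg, Pi.neg_apply] at hm hmt
  have hmM : m = -M := tendsto_nhds_unique hmt hMt.neg
  refine ⟨M, fun ε hε => ?_⟩
  obtain ⟨N₁, h₁⟩ := hM (M + ε) (by linarith)
  obtain ⟨N₂, h₂⟩ := hm (m + ε) (by linarith)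
  refine ⟨max N₁ N₂, fun n hn t => abs_le.2 ⟨?_, ?_⟩⟩
  · linarith [h₂ n (le_of_max_le_right hn) t]
  · linarith [h₁ n (le_of_max_le_left hn) t]

end RealLine

namespace CircleDeg1Lift

theorem exists_tendsto_iterate_of_fixed (S : CircleDeg1Lift) {y : ℝ} (hy : S y = y) (x : ℝ) :
    ∃ l, Tendsto (fun k => S^[k] x) atTop (𝓝 l) := by
  have hfix : ∀ (m : ℤ) k, S^[k] (y + m) = y + m := fun m k =>
    iterate_fixed (by rw [S.map_add_int, hy]) k
  rcases le_total x (S x) with h | h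
  · refine ⟨_, tendsto_atTop_ciSup (S.monotone.monotone_iterate_of_le_map h)
      ⟨y + ⌈x - y⌉, ?_⟩⟩
    rintro _ ⟨k, rfl⟩
    refine (S.monotone.iterate k ?_).trans (hfix _ k).le
    linarith [Int.le_ceil (x - y)]
  · refine ⟨_, tendsto_atTop_ciInf (S.monotone.antitone_iterate_of_map_le h)
      ⟨y + ⌊x - y⌋, ?_⟩⟩
    rintro _ ⟨k, rfl⟩
    refine (hfix _ k).ge.trans (S.monotone.iterate k ?_)
    linarith [Int.floor_le (x - y)]

variable {G : CircleDeg1Lift} {x : ℝ}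

theorem irrational_translationNumber_of_dense (hG : Continuous G)
    (hx : Dense (Set.range fun n : ℕ => ((G^[n + 1] x : ℝ) : S1))) :
    Irrational G.translationNumber := by
  rintro ⟨r, hr⟩
  obtain ⟨y, hy⟩ := (G.translationNumber_eq_rat_iff hG r.den_pos (m := r.num)).1
    (hr.symm.trans (Rat.cast_def r))
  let S : CircleDeg1Lift := ⟨⟨fun t => (G ^ r.den) t - r.num, fun s t hst =>
    sub_le_sub_right ((G ^ r.den).monotone hst) _⟩, fun t => by
      simp only [(G ^ r.den).map_add_one]; ring⟩
  have hS : ∀ t, S t = (G ^ r.den) t - r.num := fun t => rfl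
  obtain ⟨l, hl⟩ := S.exists_tendsto_iterate_of_fixed (y := y) (by rw [hS, hy]; ring) x
  have hiter : ∀ k : ℕ, G^[r.den * k] x = S^[k] x + ((k * r.num : ℤ) : ℝ) := fun k => by
    rw [iterate_mul, ← coe_pow]
    induction k with
    | zero => simp
    | succ k ih =>
      rw [iterate_succ_apply', ih, iterate_succ_apply', map_add_int, hS]
      push_cast
      ring
  let v : ℕ → ℕ → S1 := fun j k => ((G^[j] (S^[k] x) : ℝ) : S1)
  have hv : ∀ j, Tendsto (v j) atTop (𝓝 ((G^[j] l : ℝ) : S1)) := fun j =>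
    (((AddCircle.continuous_mk' 1).comp (hG.iterate j)).tendsto l).comp hl
  let K : Set S1 := ⋃ j ∈ Finset.range r.den, insert ((G^[j] l : ℝ) : S1) (Set.range (v j))
  have hK : IsCompact K := (Finset.range r.den).isCompact_biUnion fun j _ =>
    (hv j).isCompact_insert_range
  have hKc : K.Countable := (Finset.range r.den).countable_toSet.biUnion fun j _ =>
    (Set.countable_range _).insert _
  have hsub : (Set.range fun n : ℕ => ((G^[n + 1] x : ℝ) : S1)) ⊆ K := by
    rintro _ ⟨n, rfl⟩
    refine Set.mem_biUnion (Finset.mem_coe.2 (Finset.mem_range.2 (Nat.mod_lt (n + 1) r.den_pos)))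
      (Set.mem_insert_of_mem _ ⟨(n + 1) / r.den, ?_⟩)
    have h1 : G^[n + 1] x = G^[(n + 1) % r.den] (S^[(n + 1) / r.den] x) +
        ((((n + 1) / r.den : ℕ) * r.num : ℤ) : ℝ) := by
      conv_lhs => rw [← Nat.mod_add_div (n + 1) r.den]
      rw [iterate_add_apply, hiter, ← coe_pow, map_add_int]
    simp only [v, h1]
    exact (sub_eq_zero.1 ((AddCircle.coe_eq_zero_iff (1 : ℝ)).2
      ⟨(((n + 1) / r.den : ℕ) * r.num : ℤ), by simp⟩)).symm
  have huniv : K = Set.univ := Set.univ_subset_iff.1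
    (hx.closure_eq.symm.subset.trans (closure_minimal hsub hK.isClosed))
  have : NullSingletonClass (volume : Measure S1) :=
    ⟨fun x => by rw [← Metric.closedBall_zero, AddCircle.volume_closedBall]; simp⟩
  have h0 := hKc.measure_zero (volume : Measure S1)
  rw [huniv, AddCircle.measure_univ] at h0
  simp at h0

theorem exists_iterate_add_int_mem_Ioo
    (hx : Dense (Set.range fun n : ℕ => ((G^[n + 1] x : ℝ) : S1))) {c d : ℝ} (h : c < d) :
    ∃ (n : ℕ) (m : ℤ), G^[n] x + m ∈ Set.Ioo c d := by
  obtain ⟨_, ⟨y, hy, hyn⟩, n, rfl⟩ := hx.inter_open_nonempty _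
    (QuotientAddGroup.isOpenMap_coe (N := AddSubgroup.zmultiples (1 : ℝ)) _
      (isOpen_Ioo (a := c) (b := d))) ((Set.nonempty_Ioo.2 h).image _)
  obtain ⟨m, hm⟩ := (AddCircle.coe_eq_zero_iff (1 : ℝ)).1
    (show ((y - G^[n + 1] x : ℝ) : S1) = 0 from sub_eq_zero.2 hyn)
  refine ⟨n + 1, m, ?_⟩
  rwa [show G^[n + 1] x + m = y by simp at hm ⊢; linarith]

/-- A lift with a dense orbit on the circle is conjugate to an irrational translation. -/
theorem exists_conj_translation (hG : Continuous G) (hGm : StrictMono G)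
    (hx : Dense (Set.range fun n : ℕ => ((G^[n + 1] x : ℝ) : S1))) :
    ∃ (α : ℝ) (F : CircleDeg1Lift), Irrational α ∧ Continuous F ∧ StrictMono F ∧
      ∀ t, F (G t) = F t + α := by
  set α := G.translationNumber with hα'
  have hα : Irrational α := irrational_translationNumber_of_dense hG hx
  obtain ⟨F, hF⟩ := semiconj_of_bijective_of_translationNumber_eq (f₁ := G)
    (f₂ := translate (Multiplicative.ofAdd α)) ⟨hGm.injective, G.continuous_iff_surjective.1 hG⟩
    (isUnit_iff_bijective.1 (Units.isUnit _)) (translationNumber_translate α).symm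
  have hFG : ∀ t, F (G t) = F t + α := fun t => by
    rw [hF t, translate_apply, add_comm]
  have hFn : ∀ (n : ℕ) t, F (G^[n] t) = F t + n * α := fun n t => by
    induction n with
    | zero => simp
    | succ n ih => rw [iterate_succ_apply', hFG, ih]; push_cast; ring
  refine ⟨α, F, hα, F.monotone.continuous_of_denseRange (dense_of_exists_between fun a b hab => ?_),
    F.monotone.strictMono_of_injective fun a b h => ?_, hFG⟩
  · obtain ⟨n, m, h1, h2⟩ := hα.exists_nat_mul_add_int_mem_Ioo (sub_lt_sub_right hab (F 0))
    refine ⟨_, ⟨G^[n] 0 + m, rfl⟩, ?_⟩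
    rw [map_add_int, hFn]
    constructor <;> linarith
  · by_contra hne
    wlog hab : a < b generalizing a b
    · exact this b a h.symm (Ne.symm hne) (lt_of_le_of_ne (not_lt.1 hab) (Ne.symm hne))
    obtain ⟨n, m, hn1, hn2⟩ := exists_iterate_add_int_mem_Ioo hx
      (show a < (a + b) / 2 by linarith)
    obtain ⟨n', m', hn1', hn2'⟩ := exists_iterate_add_int_mem_Ioo hx
      (show (a + b) / 2 < b by linarith)
    have hconst : ∀ s, a < s → s < b → F s = F a := fun s h1 h2 =>
      le_antisymm ((F.monotone h2.le).trans h.ge) (F.monotone h1.le)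
    have h1 := hconst _ hn1 (by linarith)
    have h2 := hconst _ (by linarith) hn2'
    rw [map_add_int, hFn] at h1 h2
    have h3 : ((n : ℤ) - n' : ℤ) * α = ((m' - m : ℤ) : ℝ) := by
      push_cast
      linarith
    have hnn : n = n' := by
      by_contra hnn
      refine (hα.intCast_mul (m := (n : ℤ) - n') (by omega)).ne_int (m' - m) h3
    subst hnn
    have hmm : (m : ℝ) = m' := by linarith
    rw [hmm] at hn2
    linarith

end CircleDeg1Lift

theorem UnitAddCircle.ofReal_min_le_volume_image_Ioo (c d : ℝ) :
    ENNReal.ofReal (min d (c + 1) - c) ≤ volume ((fun t : ℝ => (t : S1)) '' Set.Ioo c d) := by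
  have hopen : IsOpen ((fun t : ℝ => (t : S1)) '' Set.Ioo c d) :=
    QuotientAddGroup.isOpenMap_coe (N := AddSubgroup.zmultiples (1 : ℝ)) _ isOpen_Ioo
  rw [← Real.volume_Ioo, AddCircle.add_projection_respects_measure (1 : ℝ) c hopen.measurableSet]
  refine measure_mono fun t ht => ⟨⟨t, ⟨ht.1, ht.2.trans_le (min_le_left _ _)⟩, rfl⟩, ht.1,
    (ht.2.trans_le (min_le_right _ _)).le⟩

theorem OrderIso.symm_add_int {E : ℝ ≃o ℝ} (hE : ∀ t, E (t + 1) = E t + 1) (t : ℝ) (m : ℤ) :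
    E.symm (t + m) = E.symm t + m := by
  rw [E.symm_apply_eq]
  have h := (⟨⟨E, E.monotone⟩, hE⟩ : CircleDeg1Lift).map_add_int (E.symm t) m
  exact ((congrArg (· + (m : ℝ)) (E.apply_symm_apply t)).symm.trans h.symm)

/-- The lifts of a contractive family are not simultaneously conjugate to translations. -/
theorem Contractive.exists_displacement_lt {k : ℕ} {g : Fin k → S1 ≃ₜ S1} (hg : Contractive g)
    {G : Fin k → CircleDeg1Lift} (hG : ∀ i (t : ℝ), g i (t : S1) = ((G i t : ℝ) : S1))
    {E : ℝ ≃o ℝ} (hE : ∀ t, E (t + 1) = E t + 1) :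
    ∃ i s t, E (G i s) - E s < E (G i t) - E t := by
  by_contra! h
  have hβ : ∀ i t, E (G i t) = E t + (E (G i 0) - E 0) := fun i t => by
    linarith [h i t 0, h i 0 t]
  have hw : ∀ w, ∃ β, ∀ t : ℝ, applyWord g w (t : S1) = ((E.symm (E t + β) : ℝ) : S1) :=
    fun w => by
      induction w with
      | nil => exact ⟨0, fun t => by simp [applyWord]⟩
      | cons i w ih =>
        obtain ⟨β, ih⟩ := ih
        refine ⟨E (G i 0) - E 0 + β, fun t => ?_⟩
        change applyWord g w (g i t) = _
        rw [hG, ih, hβ, add_assoc]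
  obtain ⟨a, b, hab, -, -, w, hlim⟩ := hg 0
  let d : ℝ → ℝ := fun β => E.symm (E b + β) - E.symm (E a + β)
  have hd : Continuous d := by
    have := E.symm.continuous
    fun_prop
  obtain ⟨x, -, hx⟩ := isCompact_Icc.exists_isMinOn (Set.nonempty_Icc.2 (zero_le_one' ℝ))
    hd.continuousOn
  have hdx : 0 < d x := sub_pos.2 (E.symm.strictMono (by linarith [E.strictMono hab]))
  have hmin : ∀ β, d x ≤ d β := fun β => by
    have h1 : d x ≤ d (Int.fract β) := hx ⟨Int.fract_nonneg β, (Int.fract_lt_one β).le⟩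
    have h2 : d (Int.fract β + ⌊β⌋) = d (Int.fract β) := by
      simp only [d, ← add_assoc, OrderIso.symm_add_int hE]
      ring
    rwa [← h2, Int.fract_add_floor] at h1
  have hpos : 0 < ENNReal.ofReal (min (d x) 1) := ENNReal.ofReal_pos.2 (lt_min hdx one_pos)
  obtain ⟨m, hm⟩ := (hlim.eventually (gt_mem_nhds hpos)).exists
  refine hm.not_ge ?_
  obtain ⟨β, hβw⟩ := hw (w m)
  refine le_trans (ENNReal.ofReal_le_ofReal ?_) ((UnitAddCircle.ofReal_min_le_volume_image_Ioo
    (E.symm (E a + β)) (E.symm (E b + β))).trans (measure_mono ?_))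
  · rw [← min_sub_sub_right, add_sub_cancel_left]
    exact min_le_min_right _ (hmin β)
  · rintro _ ⟨y, ⟨hy1, hy2⟩, rfl⟩
    rw [E.symm_apply_lt] at hy1
    rw [E.lt_symm_apply] at hy2
    refine ⟨_, ⟨E.symm (E y - β), ⟨?_, ?_⟩, rfl⟩, ?_⟩
    · rw [E.lt_symm_apply]; linarith
    · rw [E.symm_apply_lt]; linarith
    · rw [hβw]; simp

theorem exists_uniform_limit_dualP_iterate {k : ℕ} {g : Fin k → S1 ≃ₜ S1}
    (hg : ∀ i, IsOPH (g i)) (hadm : Admissible g) (hcontr : Contractive g)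
    {p : Fin k → ℝ} (hp : ∀ i, 0 < p i) (hsum : ∑ i, p i = 1) (f : C(S1, ℝ)) :
    ∃ c : ℝ, ∀ ε > 0, ∃ N, ∀ n ≥ N, ∀ x, |(dualP p g)^[n] f x - c| ≤ ε := by
  choose G' hGm hGc hG1 hGg using hg
  let G : Fin k → CircleDeg1Lift := fun i => ⟨⟨G' i, (hGm i).monotone⟩, hG1 i⟩
  have hGg : ∀ i (t : ℝ), g i (t : S1) = ((G i t : ℝ) : S1) := hGg
  have hGn : ∀ i n (t : ℝ), (g i)^[n] (t : S1) = (((G i)^[n] t : ℝ) : S1) := fun i n t => by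
    induction n with
    | zero => rfl
    | succ n ih => rw [iterate_succ_apply', iterate_succ_apply', ih, hGg]
  obtain ⟨i₀, x, hx⟩ := hadm
  obtain ⟨x, rfl⟩ := QuotientAddGroup.mk_surjective x
  obtain ⟨α, F, hα, hFc, hFm, hFG⟩ := CircleDeg1Lift.exists_conj_translation (G := G i₀) (x := x)
    (hGc i₀) (hGm i₀) (by simpa only [← hGn] using hx)
  let E : ℝ ≃o ℝ := hFm.orderIsoOfSurjective F (F.continuous_iff_surjective.1 hFc)
  have hE : ∀ t, E (t + 1) = E t + 1 := F.map_add_one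
  have hE1 : ∀ t, E.symm (t + 1) = E.symm t + 1 := fun t => by
    simpa using OrderIso.symm_add_int hE t 1
  let H : Fin k → CircleDeg1Lift := fun i =>
    ⟨⟨fun t => E (G i (E.symm t)), fun s t hst =>
      E.monotone ((G i).monotone (E.symm.monotone hst))⟩, fun t => by
        simp only [hE1, CircleDeg1Lift.map_add_one, hE]⟩
  have hH : ∀ i t, H i t = E (G i (E.symm t)) := fun i t => rfl
  obtain ⟨i₁, s, t, hst⟩ := hcontr.exists_displacement_lt hGg hE
  have hper : Periodic (fun t : ℝ => f (E.symm t : S1)) 1 := fun t => by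
    simp [hE1]
  have hcont : Continuous fun t : ℝ => f (E.symm t : S1) :=
    f.continuous.comp ((AddCircle.continuous_mk' 1).comp E.symm.continuous)
  have huc : UniformContinuous fun t : ℝ => f (E.symm t : S1) := by
    have h1 : Continuous (hper.lift : S1 → ℝ) := hcont.quotient_lift _
    exact (CompactSpace.uniformContinuous_of_continuous h1).comp
      (uniformContinuous_of_continuousAt_zero
        (QuotientAddGroup.mk' (AddSubgroup.zmultiples (1 : ℝ)))
        (AddCircle.continuous_mk' (1 : ℝ)).continuousAt)
  obtain ⟨M, hM⟩ := exists_uniform_limit_avgOp_iterate (H := H) (i₀ := i₀) (i₁ := i₁) hp hsum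
    (fun i => E.continuous.comp ((hGc i).comp E.symm.continuous)) hα
    (fun t => (hFG _).trans (congrArg (· + α) (E.apply_symm_apply t)))
    ⟨E s, E t, by simpa [hH] using hst⟩ huc hper (C := ‖f‖) fun t => f.norm_coe_le_norm _
  have hconj : ∀ n (t : ℝ), (avgOp p fun i => H i)^[n] (fun t : ℝ => f (E.symm t : S1)) t =
      (dualP p g)^[n] f (E.symm t : S1) := fun n => by
    induction n with
    | zero => exact fun t => rfl
    | succ n ih =>
      intro t
      simp only [iterate_succ_apply', avgOp, dualP, ih, hH, hGg, E.symm_apply_apply]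
  refine ⟨M, fun ε hε => ?_⟩
  obtain ⟨N, hN⟩ := hM ε hε
  refine ⟨N, fun n hn y => ?_⟩
  obtain ⟨y, rfl⟩ := QuotientAddGroup.mk_surjective y
  have h1 := hN n hn (E y)
  rwa [hconj, E.symm_apply_apply] at h1

section MarkovOperator

variable {k : ℕ} {g : Fin k → S1 ≃ₜ S1} {p : Fin k → ℝ}

theorem isProbabilityMeasure_markovP (hp : ∀ i, 0 < p i) (hsum : ∑ i, p i = 1) (μ : Measure S1)
    [IsProbabilityMeasure μ] : IsProbabilityMeasure (markovP p g μ) := by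
  refine ⟨?_⟩
  have h : ∀ i, Measure.map (g i) μ Set.univ = 1 := fun i => by
    rw [Measure.map_apply (g i).continuous.measurable MeasurableSet.univ, Set.preimage_univ,
      measure_univ]
  simp only [markovP, Measure.finsetSum_apply, Measure.smul_apply, h, smul_eq_mul, mul_one]
  rw [← ENNReal.ofReal_sum_of_nonneg fun i _ => (hp i).le, hsum, ENNReal.ofReal_one]

theorem isProbabilityMeasure_markovP_iterate (hp : ∀ i, 0 < p i) (hsum : ∑ i, p i = 1)
    (μ : Measure S1) [hμ : IsProbabilityMeasure μ] (n : ℕ) :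
    IsProbabilityMeasure ((markovP p g)^[n] μ) := by
  induction n with
  | zero => exact hμ
  | succ n ih =>
    rw [iterate_succ_apply']
    exact isProbabilityMeasure_markovP hp hsum _

theorem continuous_dualP {f : S1 → ℝ} (hf : Continuous f) : Continuous (dualP p g f) :=
  continuous_finsetSum _ fun i _ => (hf.comp (g i).continuous).const_mul (p i)

theorem continuous_dualP_iterate {f : S1 → ℝ} (hf : Continuous f) (n : ℕ) :
    Continuous ((dualP p g)^[n] f) := by
  induction n with
  | zero => exact hf
  | succ n ih =>
    rw [iterate_succ_apply']
    exact continuous_dualP ih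

theorem Continuous.integrable_of_finite {f : S1 → ℝ} (hf : Continuous f) (μ : Measure S1)
    [IsFiniteMeasure μ] : Integrable f μ :=
  hf.integrable_of_hasCompactSupport (HasCompactSupport.of_compactSpace f)

theorem integral_markovP (hp : ∀ i, 0 < p i) (μ : Measure S1) [IsFiniteMeasure μ] {f : S1 → ℝ}
    (hf : Continuous f) : ∫ x, f x ∂(markovP p g μ) = ∫ x, dualP p g f x ∂μ := by
  have hi : ∀ i, Integrable f (Measure.map (g i) μ) := fun i => hf.integrable_of_finite _
  simp only [markovP, dualP]
  rw [integral_finsetSum_measure fun i _ => (hi i).smul_measure ENNReal.ofReal_ne_top,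
    integral_finsetSum _ fun i _ => Integrable.const_mul
      (f := fun x => f (g i x)) ((hf.comp (g i).continuous).integrable_of_finite μ) (p i)]
  refine Finset.sum_congr rfl fun i _ => ?_
  rw [integral_smul_measure, ENNReal.toReal_ofReal (hp i).le, smul_eq_mul,
    integral_map (g i).continuous.aemeasurable hf.aestronglyMeasurable, integral_const_mul]

theorem integral_markovP_iterate (hp : ∀ i, 0 < p i) (hsum : ∑ i, p i = 1) (μ : Measure S1)
    [IsProbabilityMeasure μ] {f : S1 → ℝ} (hf : Continuous f) (n : ℕ) :
    ∫ x, f x ∂((markovP p g)^[n] μ) = ∫ x, (dualP p g)^[n] f x ∂μ := by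
  induction n generalizing f with
  | zero => rfl
  | succ n ih =>
    have := isProbabilityMeasure_markovP_iterate (g := g) hp hsum μ n
    rw [iterate_succ_apply', integral_markovP hp _ hf, ih (continuous_dualP hf),
      iterate_succ_apply]

theorem asympStable_of_uniform_limit (hp : ∀ i, 0 < p i) (hsum : ∑ i, p i = 1)
    (h : ∀ f : C(S1, ℝ), ∃ c : ℝ, ∀ ε > 0, ∃ N, ∀ n ≥ N, ∀ x, |(dualP p g)^[n] f x - c| ≤ ε) :
    AsympStable p g := by
  choose c hc using h
  have hlim : ∀ (μ : Measure S1) [IsProbabilityMeasure μ] (f : C(S1, ℝ)),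
      Tendsto (fun n => ∫ x, f x ∂((markovP p g)^[n] μ)) atTop (𝓝 (c f)) := fun μ _ f => by
    refine Metric.tendsto_atTop.2 fun ε hε => ?_
    obtain ⟨N, hN⟩ := hc f (ε / 2) (half_pos hε)
    refine ⟨N, fun n hn => ?_⟩
    rw [integral_markovP_iterate hp hsum μ f.continuous, Real.dist_eq]
    have h1 : ∫ x, (dualP p g)^[n] f x ∂μ - c f = ∫ x, ((dualP p g)^[n] f x - c f) ∂μ := by
      rw [integral_sub ((continuous_dualP_iterate f.continuous n).integrable_of_finite μ)
        (integrable_const _)]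
      simp
    rw [h1, ← Real.norm_eq_abs]
    refine (norm_integral_le_of_norm_le_const (C := ε / 2)
      (Eventually.of_forall fun x => hN n hn x)).trans_lt ?_
    simpa using half_lt_self hε
  let u : ℕ → ProbabilityMeasure S1 := fun n => ⟨(markovP p g)^[n] (Measure.dirac 0),
    isProbabilityMeasure_markovP_iterate hp hsum _ n⟩
  obtain ⟨μs, -, hμs⟩ := (hyperfilter ℕ).exists_tendsto_of_isCompact isCompact_univ
    (u := u) fun n => Set.mem_univ _
  have hμs_int : ∀ f : C(S1, ℝ), ∫ x, f x ∂(μs : Measure S1) = c f := fun f =>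
    tendsto_nhds_unique (ProbabilityMeasure.tendsto_iff_forall_integral_tendsto.1 hμs
      (BoundedContinuousFunction.mkOfCompact f))
      ((hlim (Measure.dirac 0) f).mono_left Nat.hyperfilter_le_atTop)
  have hext : ∀ ν : Measure S1, IsProbabilityMeasure ν →
      (∀ f : C(S1, ℝ), ∫ x, f x ∂ν = c f) → ν = μs := fun ν _ hν =>
    ext_of_forall_integral_eq_of_IsFiniteMeasure fun f =>
      (hν f.toContinuousMap).trans (hμs_int f.toContinuousMap).symm
  refine ⟨μs, inferInstance, hext _ (isProbabilityMeasure_markovP hp hsum _) fun f => ?_,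
    fun ν hν hinv => hext ν hν fun f => ?_, fun μ hμ f => hμs_int f ▸ hlim μ f⟩
  · let f' : C(S1, ℝ) := ⟨dualP p g f, continuous_dualP f.continuous⟩
    rw [integral_markovP hp _ f.continuous]
    refine (hμs_int f').trans (tendsto_nhds_unique (hlim (Measure.dirac 0) f')
      (((hlim (Measure.dirac 0) f).comp (tendsto_add_atTop_nat 1)).congr fun n => ?_))
    have := isProbabilityMeasure_markovP_iterate (g := g) hp hsum (Measure.dirac 0) n
    rw [comp_apply, iterate_succ_apply', integral_markovP hp _ f.continuous]
    rfl
  · refine tendsto_nhds_unique (tendsto_const_nhds.congr fun n => ?_) (hlim ν f)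
    rw [iterate_fixed hinv]

end MarkovOperator

/-- An admissible, contractive IFS of orientation-preserving circle
homeomorphisms with strictly positive probability vector is asymptotically stable. -/
theorem admissible_contractive_ifs_asymptotically_stable {k : ℕ} (g : Fin k → S1 ≃ₜ S1)
    (hg : ∀ i, IsOPH (g i)) (hadm : Admissible g) (hcontr : Contractive g)
    (p : Fin k → ℝ) (hp : ∀ i, 0 < p i) (hsum : ∑ i, p i = 1) :
    AsympStable p g := by
  exact asympStable_of_uniform_limit hp hsum
    (exists_uniform_limit_dualP_iterate hg hadm hcontr hp hsum)
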